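/- Let v : ℝ² → ℝ be a smooth function of the variables (t,x) that solves the Burgers equation ∂_t v + v·∂_x v = ∂_x² v. Then for every smooth function f : ℝ² → ℝ one has M_v(Ĝ f) = Ĝ(M_v f); that is, the operator Ĝ = t·(∂_x − v/2) + x/2 commutes with the operator M_v = ∂_t + v·∂_x − ∂_x² on solutions of the Burgers equation. -/

import Mathlib

/-- The operator `P̂ = ∂ₓ − v/2` associated with `v`. -/
noncomputable def burgP (v f : ℝ → ℝ → ℝ) : ℝ → ℝ → ℝ :=
  fun t x => deriv (f t) x - (1 / 2) * v t x * f t x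

/-- The operator `Ĝ = t P̂ + x/2` associated with `v`. -/
noncomputable def burgG (v f : ℝ → ℝ → ℝ) : ℝ → ℝ → ℝ :=
  fun t x => t * burgP v f t x + x / 2 * f t x

/-- The operator `M_v = ∂ₜ + v ∂ₓ − ∂ₓ²` associated with `v`. -/
noncomputable def burgM (v f : ℝ → ℝ → ℝ) : ℝ → ℝ → ℝ :=
  fun t x => deriv (fun s => f s x) t + v t x * deriv (f t) x - deriv (deriv (f t)) x

open scoped ContDiff

section PartialDerivatives

variable {g : ℝ → ℝ → ℝ}

lemma hasDerivAt_snd_fderiv_uncurry (hg : Differentiable ℝ (Function.uncurry g)) (t x : ℝ) :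
    HasDerivAt (g t) (fderiv ℝ (Function.uncurry g) (t, x) (0, 1)) x :=
  (hg (t, x)).hasFDerivAt.comp_hasDerivAt x ((hasDerivAt_const x t).prodMk (hasDerivAt_id x))

lemma hasDerivAt_fst_fderiv_uncurry (hg : Differentiable ℝ (Function.uncurry g)) (t x : ℝ) :
    HasDerivAt (fun s => g s x) (fderiv ℝ (Function.uncurry g) (t, x) (1, 0)) t :=
  HasFDerivAt.comp_hasDerivAt (f := fun s => (s, x)) t (hg (t, x)).hasFDerivAt
    ((hasDerivAt_id' t).prodMk (hasDerivAt_const t x))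

lemma hasDerivAt_snd (hg : ContDiff ℝ ∞ (Function.uncurry g)) (t x : ℝ) :
    HasDerivAt (g t) (deriv (g t) x) x :=
  (hasDerivAt_snd_fderiv_uncurry (hg.differentiable (by simp)) t x).differentiableAt.hasDerivAt

lemma hasDerivAt_fst (hg : ContDiff ℝ ∞ (Function.uncurry g)) (t x : ℝ) :
    HasDerivAt (fun s => g s x) (deriv (fun s => g s x) t) t :=
  (hasDerivAt_fst_fderiv_uncurry (hg.differentiable (by simp)) t x).differentiableAt.hasDerivAt

lemma uncurry_deriv_snd (hg : Differentiable ℝ (Function.uncurry g)) :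
    Function.uncurry (fun t x => deriv (g t) x) =
      fun p => fderiv ℝ (Function.uncurry g) p (0, 1) := by
  ext ⟨t, x⟩
  exact (hasDerivAt_snd_fderiv_uncurry hg t x).deriv

lemma uncurry_deriv_fst (hg : Differentiable ℝ (Function.uncurry g)) :
    Function.uncurry (fun t x => deriv (fun s => g s x) t) =
      fun p => fderiv ℝ (Function.uncurry g) p (1, 0) := by
  ext ⟨t, x⟩
  exact (hasDerivAt_fst_fderiv_uncurry hg t x).deriv

lemma contDiff_uncurry_deriv_snd (hg : ContDiff ℝ ∞ (Function.uncurry g)) :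
    ContDiff ℝ ∞ (Function.uncurry fun t x => deriv (g t) x) := by
  rw [uncurry_deriv_snd (hg.differentiable (by simp))]
  exact (hg.fderiv_right (by simp)).clm_apply contDiff_const

lemma contDiff_uncurry_deriv_fst (hg : ContDiff ℝ ∞ (Function.uncurry g)) :
    ContDiff ℝ ∞ (Function.uncurry fun t x => deriv (fun s => g s x) t) := by
  rw [uncurry_deriv_fst (hg.differentiable (by simp))]
  exact (hg.fderiv_right (by simp)).clm_apply contDiff_const

/-- Mixed partial derivatives of a smooth function commute. -/
lemma deriv_fst_deriv_snd_comm (hg : ContDiff ℝ ∞ (Function.uncurry g)) (t x : ℝ) :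
    deriv (fun s => deriv (g s) x) t = deriv (fun y => deriv (fun s => g s y) t) x := by
  have hd : Differentiable ℝ (Function.uncurry g) := hg.differentiable (by simp)
  have hd₂ : DifferentiableAt ℝ (fderiv ℝ (Function.uncurry g)) (t, x) :=
    (hg.fderiv_right (m := ∞) (by simp)).differentiable (by simp) _
  have h₁ := (hasDerivAt_fst_fderiv_uncurry
    ((contDiff_uncurry_deriv_snd hg).differentiable (by simp)) t x).deriv
  have h₂ := (hasDerivAt_snd_fderiv_uncurry
    ((contDiff_uncurry_deriv_fst hg).differentiable (by simp)) t x).deriv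
  rw [uncurry_deriv_snd hd, fderiv_clm_apply hd₂ (differentiableAt_const _)] at h₁
  rw [uncurry_deriv_fst hd, fderiv_clm_apply hd₂ (differentiableAt_const _)] at h₂
  have hsymm : IsSymmSndFDerivAt ℝ (Function.uncurry g) (t, x) :=
    hg.contDiffAt.isSymmSndFDerivAt (by simpa using WithTop.coe_le_coe.2 (le_top : (2 : ℕ∞) ≤ ⊤))
  rw [h₁, h₂]
  simpa using hsymm (1, 0) (0, 1)

end PartialDerivatives

/-- If a smooth `v : ℝ² → ℝ` solves the Burgers equation `∂ₜ v + v ∂ₓ v = ∂ₓ² v`, then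
for every smooth `f`, `M_v(Ĝ f) = Ĝ(M_v f)`: the operator `Ĝ = t(∂ₓ − v/2) + x/2`
commutes with `M_v = ∂ₜ + v ∂ₓ − ∂ₓ²` on solutions of the Burgers equation. -/
theorem burgers_Ghat_commutes_with_M
    (v : ℝ → ℝ → ℝ)
    (hv : ContDiff ℝ (⊤ : ℕ∞) (Function.uncurry v))
    (hburg : ∀ t x, deriv (fun s => v s x) t + v t x * deriv (v t) x
        = deriv (deriv (v t)) x)
    (f : ℝ → ℝ → ℝ)
    (hf : ContDiff ℝ (⊤ : ℕ∞) (Function.uncurry f)) :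
    ∀ t x, burgM v (burgG v f) t x = burgG v (burgM v f) t x := by
  intro t x
  have hfx := contDiff_uncurry_deriv_snd hf
  have hfxx := contDiff_uncurry_deriv_snd hfx
  have hft := contDiff_uncurry_deriv_fst hf
  have hvx := contDiff_uncurry_deriv_snd hv
  have hGx : deriv (burgG v f t) = fun y =>
      t * (deriv (deriv (f t)) y - (1 / 2) * (deriv (v t) y * f t y + v t y * deriv (f t) y))
        + (1 / 2 * f t y + y / 2 * deriv (f t) y) := by
    ext y
    have h := (((hasDerivAt_snd hfx t y).sub (((hasDerivAt_snd hv t y).const_mul (1 / 2)).mul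
      (hasDerivAt_snd hf t y))).const_mul t).add
      (((hasDerivAt_id' y).div_const 2).mul (hasDerivAt_snd hf t y))
    exact h.deriv.trans (by ring)
  have hGxx : deriv (deriv (burgG v f t)) x =
      t * (deriv (deriv (deriv (f t))) x - (1 / 2) * (deriv (deriv (v t)) x * f t x
        + 2 * deriv (v t) x * deriv (f t) x + v t x * deriv (deriv (f t)) x))
        + (deriv (f t) x + x / 2 * deriv (deriv (f t)) x) := by
    rw [hGx]
    have h := (((hasDerivAt_snd hfxx t x).sub ((((hasDerivAt_snd hvx t x).mul
      (hasDerivAt_snd hf t x)).add ((hasDerivAt_snd hv t x).mul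
      (hasDerivAt_snd hfx t x))).const_mul (1 / 2))).const_mul t).add
      (((hasDerivAt_snd hf t x).const_mul (1 / 2)).add
      (((hasDerivAt_id' x).div_const 2).mul (hasDerivAt_snd hfx t x)))
    exact h.deriv.trans (by ring)
  have hGt : deriv (fun s => burgG v f s x) t =
      burgP v f t x + t * (deriv (fun s => deriv (f s) x) t
        - (1 / 2) * (deriv (fun s => v s x) t * f t x + v t x * deriv (fun s => f s x) t))
        + x / 2 * deriv (fun s => f s x) t := by
    have h := ((hasDerivAt_id' t).mul ((hasDerivAt_fst hfx t x).sub
      (((hasDerivAt_fst hv t x).const_mul (1 / 2)).mul (hasDerivAt_fst hf t x)))).add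
      ((hasDerivAt_fst hf t x).const_mul (x / 2))
    exact h.deriv.trans (by simp only [burgP, Pi.sub_apply, Pi.mul_apply]; ring)
  have hMx : deriv (burgM v f t) x =
      deriv (fun y => deriv (fun s => f s y) t) x
        + (deriv (v t) x * deriv (f t) x + v t x * deriv (deriv (f t)) x)
        - deriv (deriv (deriv (f t))) x :=
    (((hasDerivAt_snd hft t x).add ((hasDerivAt_snd hv t x).mul (hasDerivAt_snd hfx t x))).sub
      (hasDerivAt_snd hfxx t x)).deriv
  have hM : burgM v (burgG v f) t x = deriv (fun s => burgG v f s x) t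
      + v t x * deriv (burgG v f t) x - deriv (deriv (burgG v f t)) x := rfl
  rw [hM, hGxx, hGt, hGx, deriv_fst_deriv_snd_comm hf]
  simp only [burgG, burgP, hMx]
  simp only [burgM]
  linear_combination (-(t * f t x) / 2) * hburg t x
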